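/- Let n ∈ ℕ, p ∈ [0,1], and θ ∈ ℝ. Let S ~ Binomial(n,p) and let X be an independent exponential random variable with rate λ, where 0 < λ ≤ 1. Then Pr[S + X > θ·n] ≤ exp(−n·λ·(θ − (e−1)·p)). -/

import Mathlib

/-- `Pr[S = k]` for `S ~ Binomial(n, p)`. -/
noncomputable def binomPMF (n : ℕ) (p : ℝ) (k : ℕ) : ℝ :=
  (n.choose k : ℝ) * p ^ k * (1 - p) ^ (n - k)

/-- `Pr[X > t]` for `X` an exponential random variable with rate `lam > 0`. -/
noncomputable def expTail (lam t : ℝ) : ℝ :=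
  if t ≤ 0 then 1 else Real.exp (-(lam * t))

/-- `Pr[S + X > θ·n]` for `S ~ Binomial(n, p)` and `X ~ Exponential(lam)` independent. -/
noncomputable def prAbove (n : ℕ) (p θ lam : ℝ) : ℝ :=
  ∑ k ∈ Finset.range (n + 1), binomPMF n p k * expTail lam (θ * n - k)

theorem binomPMF_nonneg {p : ℝ} (hp0 : 0 ≤ p) (hp1 : p ≤ 1) (n k : ℕ) : 0 ≤ binomPMF n p k :=
  mul_nonneg (mul_nonneg (Nat.cast_nonneg _) (pow_nonneg hp0 _))
    (pow_nonneg (sub_nonneg.2 hp1) _)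

theorem expTail_le_exp {lam : ℝ} (hl0 : 0 ≤ lam) (t : ℝ) :
    expTail lam t ≤ Real.exp (-(lam * t)) := by
  unfold expTail
  split_ifs with ht
  · exact Real.one_le_exp (neg_nonneg.2 (mul_nonpos_of_nonneg_of_nonpos hl0 ht))
  · exact le_rfl

/-- The moment generating function of the binomial distribution. -/
theorem sum_binomPMF_mul_exp (n : ℕ) (p t : ℝ) :
    ∑ k ∈ Finset.range (n + 1), binomPMF n p k * Real.exp (t * k) =
      (p * Real.exp t + (1 - p)) ^ n := by
  rw [add_pow]
  refine Finset.sum_congr rfl fun k _ => ?_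
  rw [binomPMF, mul_comm t, Real.exp_nat_mul, mul_pow]
  ring

/-- On `[0, 1]` the exponential lies below its chord. -/
theorem exp_le_one_add_mul {t : ℝ} (ht0 : 0 ≤ t) (ht1 : t ≤ 1) :
    Real.exp t ≤ 1 + (Real.exp 1 - 1) * t := by
  have h := convexOn_exp.2 (Set.mem_univ 0) (Set.mem_univ 1) (sub_nonneg.2 ht1) ht0
    (sub_add_cancel 1 t)
  simp only [smul_eq_mul, mul_zero, mul_one, zero_add, Real.exp_zero] at h
  linarith

/-- For `S ~ Binomial(n,p)` and `X ~ Exponential(lam)` independent with `0 < lam ≤ 1`,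
`Pr[S + X > θ·n] ≤ exp(−n·lam·(θ − (e−1)·p))`. -/
theorem prAbove_le_exp (n : ℕ) (p θ lam : ℝ)
    (hp0 : 0 ≤ p) (hp1 : p ≤ 1) (hl0 : 0 < lam) (hl1 : lam ≤ 1) :
    prAbove n p θ lam ≤ Real.exp (-((n : ℝ) * lam * (θ - (Real.exp 1 - 1) * p))) := by
  have hbase : p * Real.exp lam + (1 - p) ≤ Real.exp (p * ((Real.exp 1 - 1) * lam)) := by
    have h := mul_le_mul_of_nonneg_left (exp_le_one_add_mul hl0.le hl1) hp0
    linarith [Real.add_one_le_exp (p * ((Real.exp 1 - 1) * lam))]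
  have hbase0 : 0 ≤ p * Real.exp lam + (1 - p) :=
    add_nonneg (mul_nonneg hp0 (Real.exp_pos _).le) (sub_nonneg.2 hp1)
  calc prAbove n p θ lam
      ≤ ∑ k ∈ Finset.range (n + 1), binomPMF n p k * Real.exp (-(lam * (θ * n - k))) :=
        Finset.sum_le_sum fun k _ =>
          mul_le_mul_of_nonneg_left (expTail_le_exp hl0.le _) (binomPMF_nonneg hp0 hp1 n k)
    _ = Real.exp (-(lam * (θ * n))) * (p * Real.exp lam + (1 - p)) ^ n := by
        rw [← sum_binomPMF_mul_exp, Finset.mul_sum]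
        refine Finset.sum_congr rfl fun k _ => ?_
        rw [mul_left_comm, ← Real.exp_add]
        ring_nf
    _ ≤ Real.exp (-(lam * (θ * n))) * Real.exp (p * ((Real.exp 1 - 1) * lam)) ^ n := by
        gcongr
    _ = Real.exp (-((n : ℝ) * lam * (θ - (Real.exp 1 - 1) * p))) := by
        rw [← Real.exp_nat_mul, ← Real.exp_add]
        ring_nf
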